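/- Let F/K be a finite Galois extension of number fields with Galois group G, and let S and S' be two finite G-stable sets of places of F, both containing all archimedean places. Then the equality [ℤ[S']] − [O×_{F,S'}] + [Cl_{F,S'}] = [ℤ[S]] − [O×_{F,S}] + [Cl_{F,S}] holds in G₀(ℤ[G]). -/

import Mathlib

/-- A bundled finitely generated module over a ring `R`. -/
structure FGMod (R : Type) [Ring R] : Type 1 where
  carrier : Type
  [isAddCommGroup : AddCommGroup carrier]
  [isModule : Module R carrier]
  [isFinite : Module.Finite R carrier]

attribute [instance] FGMod.isAddCommGroup FGMod.isModule FGMod.isFinite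

/-- The subgroup of relations defining the Grothendieck group `G₀(R)`:
one relation `[M] = [L] + [N]` for each short exact sequence `0 → L → M → N → 0`
of finitely generated `R`-modules. -/
def G0Rel (R : Type) [Ring R] : AddSubgroup (FreeAbelianGroup (FGMod R)) :=
  AddSubgroup.closure
    { x | ∃ (L M N : FGMod R) (f : L.carrier →ₗ[R] M.carrier)
            (g : M.carrier →ₗ[R] N.carrier),
        Function.Injective f ∧ Function.Surjective g ∧ Function.Exact f g ∧
        x = FreeAbelianGroup.of M - FreeAbelianGroup.of L - FreeAbelianGroup.of N }

/-- The Grothendieck group `G₀(R)` of the category of finitely generated `R`-modules. -/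
def G0 (R : Type) [Ring R] : Type 1 :=
  FreeAbelianGroup (FGMod R) ⧸ G0Rel R

instance (R : Type) [Ring R] : AddCommGroup (G0 R) :=
  QuotientAddGroup.Quotient.addCommGroup _

/-- The class `[M] ∈ G₀(R)` of a finitely generated `R`-module `M` (junk value `0` if `M` is
not finitely generated). -/
noncomputable def G0.cls (R : Type) [Ring R] (M : Type) [AddCommGroup M] [Module R M] :
    G0 R := by
  classical
  exact
    if h : Module.Finite R M then
      QuotientAddGroup.mk (FreeAbelianGroup.of (@FGMod.mk R _ M _ _ h))
    else 0

open NumberField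
open scoped nonZeroDivisors TensorProduct

noncomputable section

variable (F : Type) [Field F] [NumberField F]

/-- The étale ℝ-algebra F_ℝ = F ⊗_ℚ ℝ. -/
abbrev FReal := ℝ ⊗[ℚ] F

/-- The canonical (finite-dimensional real vector space) topology on F_ℝ. -/
instance : TopologicalSpace (FReal F) :=
  TopologicalSpace.induced (Module.finBasis ℝ (FReal F)).equivFun inferInstance

/-- The group of fractional ideals of F. -/
abbrev IdealGroup := (FractionalIdeal (𝓞 F)⁰ F)ˣ

/-- The group of fractional ideals carries the discrete topology. -/
instance : TopologicalSpace (IdealGroup F) := ⊥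

/-- The ideal norm, as a group homomorphism to ℝˣ. -/
def idealNormHom : IdealGroup F →* ℝˣ :=
  (Units.map (Rat.castHom ℝ).toMonoidHom).comp
    (Units.map (FractionalIdeal.absNorm (R := 𝓞 F) (K := F)).toMonoidHom)

/-- The absolute value of the algebra norm on F_ℝˣ, as a group homomorphism to ℝˣ. -/
def absNormFR : (FReal F)ˣ →* ℝˣ :=
  (Units.map (absHom (α := ℝ)).toMonoidHom).comp (Units.map (Algebra.norm ℝ (S := FReal F)))

/-- The fibre product Id_F ×_{ℝ>0} F_ℝˣ, i.e. the subgroup of pairs (I, b) with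
N(I) = |Nm(b)|, formalized as the kernel of the quotient of the two norm maps. -/
def picDom : Subgroup (IdealGroup F × (FReal F)ˣ) :=
  MonoidHom.ker (((idealNormHom F).comp (MonoidHom.fst _ _)) /
    ((absNormFR F).comp (MonoidHom.snd _ _)))

/-- The map F^× → Id_F ×_{ℝ>0} F_ℝˣ, α ↦ (αO_F, α ⊗ 1). -/
def principalHom : Fˣ →* IdealGroup F × (FReal F)ˣ :=
  (toPrincipalIdeal (𝓞 F) F).prod
    (Units.map (Algebra.TensorProduct.includeRight : F →ₐ[ℚ] FReal F).toMonoidHom)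

/-- The subgroup of the fibre product coming from principal oriented Arakelov divisors. -/
def principalSub : Subgroup (picDom F) :=
  Subgroup.comap (picDom F).subtype (MonoidHom.range (principalHom F))

/-- The oriented Arakelov class group of F: the cokernel of F^× → Id_F ×_{ℝ>0} F_ℝˣ. -/
def PicTilde := picDom F ⧸ principalSub F

instance : CommGroup (PicTilde F) := QuotientGroup.Quotient.commGroup _
instance : TopologicalSpace (PicTilde F) := instTopologicalSpaceQuotient

/-- The class of an oriented Arakelov divisor in the oriented Arakelov class group. -/
def PicTilde.mk : picDom F → PicTilde F := QuotientGroup.mk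

/-- The maximal compact subgroup comp(F_ℝˣ) of F_ℝˣ: the subgroup generated by all
compact subgroups. -/
def maxCompact : Subgroup (FReal F)ˣ :=
  sSup { H : Subgroup (FReal F)ˣ | IsCompact (H : Set (FReal F)ˣ) }

/-- The image of {1} × comp(F_ℝˣ) in the oriented Arakelov class group. -/
def compImage : Subgroup (PicTilde F) :=
  Subgroup.map (QuotientGroup.mk' (principalSub F))
    (Subgroup.comap (picDom F).subtype ((⊥ : Subgroup (IdealGroup F)).prod (maxCompact F)))

/-- The Arakelov class group of F: the quotient of the oriented Arakelov class group by
the image of {1} × comp(F_ℝˣ). -/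
def PicZero := PicTilde F ⧸ compImage F

instance : CommGroup (PicZero F) := QuotientGroup.Quotient.commGroup _
instance : TopologicalSpace (PicZero F) := instTopologicalSpaceQuotient

/-- The class of an oriented Arakelov divisor in the Arakelov class group. -/
def PicZero.mk : picDom F → PicZero F := fun x => QuotientGroup.mk (PicTilde.mk F x)

/-- ℝ/ℤ. -/
abbrev RmodZ := AddCircle (1 : ℝ)

/-- The Pontryagin dual Ãr_F of the oriented Arakelov class group: the group of
continuous homomorphisms to ℝ/ℤ. -/
def ArTilde := ContinuousAddMonoidHom (Additive (PicTilde F)) RmodZ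

instance : AddCommGroup (ArTilde F) := by unfold ArTilde; infer_instance
instance : FunLike (ArTilde F) (Additive (PicTilde F)) RmodZ := by unfold ArTilde; infer_instance

/-- The Pontryagin dual Ar_F of the Arakelov class group. -/
def ArF := ContinuousAddMonoidHom (Additive (PicZero F)) RmodZ

instance : AddCommGroup (ArF F) := by unfold ArF; infer_instance
instance : FunLike (ArF F) (Additive (PicZero F)) RmodZ := by unfold ArF; infer_instance

/-- ℚ/ℤ as a ℤ-module. -/
abbrev QmodZ := ℚ ⧸ (Submodule.span ℤ {(1 : ℚ)})

variable {F} in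
/-- The automorphism of F_ℝ = ℝ ⊗_ℚ F induced by an automorphism of F over a subfield K. -/
def galFReal (K : Type) [Field K] [CharZero K] [Algebra K F] (g : F ≃ₐ[K] F) : FReal F ≃ₐ[ℚ] FReal F :=
  Algebra.TensorProduct.congr AlgEquiv.refl (g.restrictScalars ℚ)

end


namespace G0

variable {R : Type} [Ring R]

theorem cls_of_finite (M : Type) [AddCommGroup M] [Module R M] [h : Module.Finite R M] :
    cls R M = QuotientAddGroup.mk (FreeAbelianGroup.of (FGMod.mk (R := R) M)) :=
  dif_pos h

theorem cls_eq_add {L M N : Type} [AddCommGroup L] [Module R L] [AddCommGroup M] [Module R M]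
    [AddCommGroup N] [Module R N] [Module.Finite R L] [Module.Finite R M] [Module.Finite R N]
    (f : L →ₗ[R] M) (g : M →ₗ[R] N) (hf : Function.Injective f) (hg : Function.Surjective g)
    (hfg : Function.Exact f g) : cls R M = cls R L + cls R N := by
  have h : QuotientAddGroup.mk' (G0Rel R) (FreeAbelianGroup.of (FGMod.mk M) -
      FreeAbelianGroup.of (FGMod.mk L) - FreeAbelianGroup.of (FGMod.mk N)) = 0 :=
    (QuotientAddGroup.eq_zero_iff _).mpr (AddSubgroup.subset_closure
      ⟨FGMod.mk L, FGMod.mk M, FGMod.mk N, f, g, hf, hg, hfg, rfl⟩)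
  rw [map_sub, map_sub, sub_sub, sub_eq_zero] at h
  rw [cls_of_finite, cls_of_finite, cls_of_finite]
  exact h

theorem cls_congr {M N : Type} [AddCommGroup M] [Module R M] [AddCommGroup N] [Module R N]
    [Module.Finite R M] (e : M ≃ₗ[R] N) : cls R M = cls R N := by
  have : Module.Finite R N := .equiv e
  have hzero : cls R (Unit : Type) = 0 := by
    have h := cls_eq_add (R := R) (0 : (Unit : Type) →ₗ[R] (Unit : Type))
      (0 : (Unit : Type) →ₗ[R] (Unit : Type)) (fun _ _ _ => rfl) (fun _ => ⟨(), rfl⟩)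
      (fun _ => by simp)
    simpa using h
  have h := cls_eq_add (R := R) (0 : (Unit : Type) →ₗ[R] M) e.toLinearMap (fun _ _ _ => rfl)
    e.surjective (fun x => by simp [eq_comm (a := (0 : M))])
  rw [h, hzero, zero_add]

theorem cls_eq_ker_add_range [IsNoetherianRing R] {M N : Type} [AddCommGroup M] [Module R M]
    [AddCommGroup N] [Module R N] [Module.Finite R M] (f : M →ₗ[R] N) :
    cls R M = cls R (LinearMap.ker f) + cls R (LinearMap.range f) :=
  cls_eq_add (LinearMap.ker f).subtype f.rangeRestrict Subtype.val_injective
    f.surjective_rangeRestrict fun x => by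
      simp [Subtype.ext_iff]

/-- The Euler characteristic of `P`, its preimage `U` under `φ : M → N`, and the quotient
`C = N / (P + φ(M))` does not depend on `P`. -/
theorem euler_char [IsNoetherianRing R] {M N U P C : Type} [AddCommGroup M] [Module R M]
    [AddCommGroup N] [Module R N] [AddCommGroup U] [Module R U] [AddCommGroup P] [Module R P]
    [AddCommGroup C] [Module R C] (φ : M →ₗ[R] N) (ι : P →ₗ[R] N) (j : U →ₗ[R] M)
    (ψ : N →ₗ[R] C) (hι : Function.Injective ι) (hj : Function.Injective j)
    (hψ : Function.Surjective ψ)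
    (hU : LinearMap.range j = (LinearMap.range ι).comap φ)
    (hC : LinearMap.ker ψ = LinearMap.range ι ⊔ LinearMap.range φ)
    [Module.Finite R P] [Module.Finite R (LinearMap.ker φ)]
    [Module.Finite R (N ⧸ LinearMap.range φ)] :
    cls R P - cls R U + cls R C = cls R (N ⧸ LinearMap.range φ) - cls R (LinearMap.ker φ) := by
  have hmem : ∀ u, φ (j u) ∈ LinearMap.range ι := fun u => by
    have : j u ∈ LinearMap.range j := ⟨u, rfl⟩
    rwa [hU] at this
  let e := LinearEquiv.ofInjective ι hι
  let f₁ : U →ₗ[R] P := e.symm.toLinearMap ∘ₗ (φ ∘ₗ j).codRestrict _ hmem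
  have hf₁ : ∀ u, ι (f₁ u) = φ (j u) := fun u => by
    have : e (f₁ u) = (φ ∘ₗ j).codRestrict _ hmem u := e.apply_symm_apply _
    exact congrArg Subtype.val this
  let f₂ : P →ₗ[R] N ⧸ LinearMap.range φ := (LinearMap.range φ).mkQ ∘ₗ ι
  let f₃ : N ⧸ LinearMap.range φ →ₗ[R] C :=
    (LinearMap.range φ).liftQ ψ (by rw [hC]; exact le_sup_right)
  have hk : ∀ x : LinearMap.ker φ, (x : M) ∈ LinearMap.range j := fun x => by
    rw [hU, Submodule.mem_comap, LinearMap.mem_ker.mp x.2]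
    exact zero_mem _
  have ej : LinearMap.ker f₁ ≃ₗ[R] LinearMap.ker φ :=
    LinearEquiv.ofBijective ((j ∘ₗ (LinearMap.ker f₁).subtype).codRestrict _ fun u => by
      have h := hf₁ u
      rw [LinearMap.mem_ker.mp u.2, map_zero] at h
      exact h.symm)
      ⟨fun u v h => Subtype.ext (hj (congrArg Subtype.val h)), fun x => by
        obtain ⟨u, hu⟩ := hk x
        refine ⟨⟨u, hι ?_⟩, Subtype.ext hu⟩
        rw [hf₁, hu, map_zero]
        exact x.2⟩
  have : Module.Finite R (LinearMap.ker f₁) := .equiv ej.symm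
  have : Module.Finite R U := by
    rw [Module.finite_def]
    refine Submodule.fg_of_fg_map_of_fg_inf_ker f₁ (IsNoetherian.noetherian _) ?_
    rw [top_inf_eq]
    exact Module.Finite.iff_fg.mp inferInstance
  have : Module.Finite R C := .of_surjective f₃ fun c => by
    obtain ⟨n, rfl⟩ := hψ c
    exact ⟨Submodule.Quotient.mk n, rfl⟩
  have h₁ := cls_eq_ker_add_range f₁
  have h₂ := cls_eq_ker_add_range f₂
  have h₃ := cls_eq_ker_add_range f₃
  have hk₂ : LinearMap.ker f₂ = LinearMap.range f₁ := by
    ext p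
    simp only [f₂, LinearMap.mem_ker, LinearMap.comp_apply, Submodule.mkQ_apply,
      Submodule.Quotient.mk_eq_zero, LinearMap.mem_range]
    constructor
    · rintro ⟨m, hm⟩
      have : m ∈ LinearMap.range j := by rw [hU]; exact ⟨p, hm.symm⟩
      obtain ⟨u, rfl⟩ := this
      exact ⟨u, hι (by rw [hf₁, hm])⟩
    · rintro ⟨u, rfl⟩
      exact ⟨j u, (hf₁ u).symm⟩
  have hk₃ : LinearMap.ker f₃ = LinearMap.range f₂ := by
    rw [Submodule.ker_liftQ, hC, Submodule.map_sup, Submodule.mkQ_map_self, sup_bot_eq,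
      LinearMap.range_comp]
  have hr₃ : cls R (LinearMap.range f₃) = cls R C :=
    cls_congr (LinearEquiv.ofTop _ (LinearMap.range_eq_top.mpr fun c => by
      obtain ⟨n, rfl⟩ := hψ c
      exact ⟨Submodule.Quotient.mk n, rfl⟩))
  rw [h₁, h₂, h₃, hk₂, hk₃, hr₃, cls_congr ej]
  abel

end G0

section GroupRing

variable {G : Type*} [Group G]

/-- The `ℤ[G]`-module structure on an abelian group defined by an action of `G`. -/
noncomputable abbrev groupRingModule {M : Type*} [AddCommGroup M] (ρ : G →* AddMonoid.End M) :
    Module (MonoidAlgebra ℤ G) M :=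
  Module.compHom M (MonoidAlgebra.lift ℤ (AddMonoid.End M) G ρ).toRingHom

theorem groupRingModule_single_smul {M : Type*} [AddCommGroup M] (ρ : G →* AddMonoid.End M)
    (g : G) (m : M) :
    letI := groupRingModule ρ
    (MonoidAlgebra.single g (1 : ℤ) : MonoidAlgebra ℤ G) • m = ρ g m := by
  change (MonoidAlgebra.lift ℤ (AddMonoid.End M) G ρ (MonoidAlgebra.single g (1 : ℤ))) m = _
  rw [MonoidAlgebra.lift_single, one_smul]

/-- A `G`-equivariant additive map, as a `ℤ[G]`-linear map. -/
noncomputable def equivariantLinearMap {M N : Type*} [AddCommGroup M] [AddCommGroup N]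
    [Module (MonoidAlgebra ℤ G) M] [Module (MonoidAlgebra ℤ G) N] (f : M →+ N)
    (hf : ∀ (g : G) (m : M), f ((MonoidAlgebra.single g (1 : ℤ) : MonoidAlgebra ℤ G) • m) =
      (MonoidAlgebra.single g (1 : ℤ) : MonoidAlgebra ℤ G) • f m) :
    M →ₗ[MonoidAlgebra ℤ G] N :=
  MonoidAlgebra.equivariantOfLinearOfComm f.toIntLinearMap hf

theorem isNoetherianRing_groupRing [Finite G] : IsNoetherianRing (MonoidAlgebra ℤ G) := by
  have : Module.Finite ℤ (MonoidAlgebra ℤ G) := inferInstance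
  exact isNoetherian_of_tower ℤ inferInstance

theorem Module.Finite.of_addMonoidHom_surjective {A M : Type*} [AddCommGroup A]
    [Module.Finite ℤ A] [AddCommGroup M] [Module (MonoidAlgebra ℤ G) M] (f : A →+ M)
    (hf : Function.Surjective f) : Module.Finite (MonoidAlgebra ℤ G) M := by
  have : Module.Finite ℤ M := .of_surjective f.toIntLinearMap hf
  exact .of_restrictScalars_finite ℤ _ _

end GroupRing

namespace IsDedekindDomain.HeightOneSpectrum

open WithZero

/-- The inclusion of `ℕ`-valued finitely supported functions into `ℤ`-valued ones. -/
noncomputable def effective {X : Type*} : (X →₀ ℕ) →+ (X →₀ ℤ) :=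
  Finsupp.mapRange.addMonoidHom (Nat.castAddMonoidHom ℤ)

@[simp]
theorem effective_apply {X : Type*} (m : X →₀ ℕ) (v : X) :
    effective m v = m v :=
  rfl

variable {R : Type*} [CommRing R] [IsDedekindDomain R]

/-- The nonzero ideal `∏ v ^ m v`. -/
noncomputable def idealHom : (HeightOneSpectrum R →₀ ℕ) →+ Additive (Ideal R)⁰ :=
  Finsupp.liftAddHom fun v => multiplesHom _
    (Additive.ofMul ⟨v.asIdeal, mem_nonZeroDivisors_of_ne_zero v.ne_bot⟩)

theorem idealHom_single (v : HeightOneSpectrum R) (n : ℕ) :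
    ((idealHom (Finsupp.single v n)).toMul : Ideal R) = v.asIdeal ^ n := by
  simp [idealHom]

theorem eq_of_asIdeal_dvd {v w : HeightOneSpectrum R} (h : v.asIdeal ∣ w.asIdeal) : v = w :=
  HeightOneSpectrum.ext
    (w.isMaximal.eq_of_le v.isPrime.ne_top (Ideal.le_of_dvd h)).symm

theorem emultiplicity_idealHom (v : HeightOneSpectrum R) (m : HeightOneSpectrum R →₀ ℕ) :
    emultiplicity v.asIdeal ((idealHom m).toMul : Ideal R) = m v := by
  induction m using Finsupp.induction_linear with
  | zero =>
    rw [map_zero]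
    exact emultiplicity_of_one_right (mt Ideal.isUnit_iff.mp v.isPrime.ne_top)
  | add f g hf hg =>
    rw [map_add, toMul_add, Submonoid.coe_mul, emultiplicity_mul v.prime, hf, hg]
    simp
  | single w n =>
    rw [idealHom_single]
    by_cases h : w = v
    · subst h
      rw [emultiplicity_pow_self w.ne_bot (mt Ideal.isUnit_iff.mp w.isPrime.ne_top)]
      simp
    · rw [Finsupp.single_eq_of_ne (Ne.symm h), Nat.cast_zero, emultiplicity_eq_zero]
      exact fun hd => h (eq_of_asIdeal_dvd (v.prime.dvd_of_dvd_pow hd)).symm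

theorem exists_idealHom_eq {I : Ideal R} (hI : I ≠ 0) :
    ∃ m : HeightOneSpectrum R →₀ ℕ, ((idealHom m).toMul : Ideal R) = I := by
  induction I using UniqueFactorizationMonoid.induction_on_prime with
  | h₁ => exact absurd rfl hI
  | h₂ I h =>
    refine ⟨0, ?_⟩
    rw [map_zero, toMul_zero, Submonoid.coe_one, Ideal.one_eq_top, Ideal.isUnit_iff.mp h]
  | h₃ I p hI0 hp ih =>
    obtain ⟨m, hm⟩ := ih hI0
    refine ⟨Finsupp.single ⟨p, Ideal.isPrime_of_prime hp, hp.ne_zero⟩ 1 + m, ?_⟩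
    rw [map_add, toMul_add, Submonoid.coe_mul, hm, idealHom_single, pow_one]

theorem intValuation_of_span_eq_idealHom {a : R} {m : HeightOneSpectrum R →₀ ℕ}
    (h : Ideal.span {a} = ((idealHom m).toMul : Ideal R)) (v : HeightOneSpectrum R) :
    v.intValuation a = exp (-(m v : ℤ)) := by
  apply le_antisymm
  · rw [intValuation_le_exp_iff_le_emultiplicity, h, emultiplicity_idealHom]
  · rw [exp_le_intValuation_iff_emultiplicity_le, h, emultiplicity_idealHom]

section Divisor

variable (K : Type*) [Field K] [Algebra R K] [IsFractionRing R K]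

theorem valuation_units_ne_zero (v : HeightOneSpectrum R) (x : Kˣ) : v.valuation K (x : K) ≠ 0 :=
  (Valuation.ne_zero_iff _).mpr x.ne_zero

theorem finite_log_valuation_ne_zero (x : Kˣ) :
    (Function.support fun v : HeightOneSpectrum R => -log (v.valuation K (x : K))).Finite := by
  refine ((Support.finite R (x : K)).union (Support.finite R ((x⁻¹ : Kˣ) : K))).subset ?_
  intro v hv
  have h0 := valuation_units_ne_zero K v x
  by_contra hc
  simp only [Support, Set.mem_union, Set.mem_ofPred_eq, not_or, not_lt, Units.val_inv_eq_inv_val,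
    map_inv₀] at hc
  have h1 : v.valuation K (x : K) = 1 :=
    le_antisymm hc.1 ((inv_le_one₀ (zero_lt_iff.mpr h0)).mp hc.2)
  simp [h1] at hv

/-- The divisor of an element of the fraction field. -/
noncomputable def divisor : Additive Kˣ →+ (HeightOneSpectrum R →₀ ℤ) where
  toFun x := Finsupp.ofSupportFinite _ (finite_log_valuation_ne_zero K x.toMul)
  map_zero' := by
    ext v
    simp [Finsupp.ofSupportFinite]
  map_add' x y := by
    ext v
    simp only [Finsupp.ofSupportFinite, Finsupp.coe_mk, Finsupp.add_apply, toMul_add,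
      Units.val_mul, map_mul]
    rw [log_mul (valuation_units_ne_zero K v _) (valuation_units_ne_zero K v _), neg_add]
    rfl

@[simp]
theorem divisor_apply (x : Additive Kˣ) (v : HeightOneSpectrum R) :
    divisor K x v = -log (v.valuation K (x.toMul : K)) :=
  rfl

theorem divisor_eq_zero_iff (x : Additive Kˣ) (v : HeightOneSpectrum R) :
    divisor K x v = 0 ↔ v.valuation K (x.toMul : K) = 1 := by
  rw [divisor_apply, neg_eq_zero]
  constructor
  · intro h
    rw [← exp_log (valuation_units_ne_zero K v x.toMul), h, exp_zero]
  · intro h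
    rw [h, log_one]

theorem exists_divisor_eq_effective {a : R} {x : Kˣ} (hx : algebraMap R K a = x) :
    ∃ m : HeightOneSpectrum R →₀ ℕ, Ideal.span {a} = ((idealHom m).toMul : Ideal R) ∧
      divisor K (Additive.ofMul x) = effective m := by
  have ha : a ≠ 0 := by
    rintro rfl
    exact x.ne_zero (by rw [← hx, map_zero])
  obtain ⟨m, hm⟩ := exists_idealHom_eq (I := Ideal.span {a})
    (by rwa [Ideal.zero_eq_bot, Ne, Ideal.span_singleton_eq_bot])
  refine ⟨m, hm.symm, ?_⟩
  ext v
  rw [divisor_apply, toMul_ofMul, ← hx, valuation_of_algebraMap,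
    intValuation_of_span_eq_idealHom hm.symm, log_exp, effective_apply, neg_neg]

end Divisor

section ClassGroup

variable (A : Type*) [CommRing A] [IsDedekindDomain A] [Algebra R A] [FaithfulSMul R A]

/-- Extension of nonzero ideals to a larger Dedekind domain. -/
def extendIdeal : (Ideal R)⁰ →* (Ideal A)⁰ where
  toFun I := ⟨(I : Ideal R).map (algebraMap R A), by
    refine mem_nonZeroDivisors_of_ne_zero fun h => nonZeroDivisors.coe_ne_zero I ?_
    rwa [Ideal.zero_eq_bot,
      Ideal.map_eq_bot_iff_of_injective (FaithfulSMul.algebraMap_injective R A)] at h⟩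
  map_one' := Subtype.ext (by simp [Ideal.one_eq_top, Ideal.map_top])
  map_mul' I J := Subtype.ext (by simp [Ideal.map_mul])

@[simp]
theorem coe_extendIdeal (I : (Ideal R)⁰) :
    (extendIdeal A I : Ideal A) = (I : Ideal R).map (algebraMap R A) :=
  rfl

/-- The ideal class in `A` of a divisor on `R`. -/
noncomputable def divisorClass : (HeightOneSpectrum R →₀ ℤ) →+ Additive (ClassGroup A) :=
  Finsupp.liftAddHom fun v => zmultiplesHom _ (Additive.ofMul (ClassGroup.mk0
    (extendIdeal A ⟨v.asIdeal, mem_nonZeroDivisors_of_ne_zero v.ne_bot⟩)))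

theorem divisorClass_single (v : HeightOneSpectrum R) (n : ℤ) :
    divisorClass A (Finsupp.single v n) = n • Additive.ofMul (ClassGroup.mk0
      (extendIdeal A ⟨v.asIdeal, mem_nonZeroDivisors_of_ne_zero v.ne_bot⟩)) := by
  simp [divisorClass]

theorem divisorClass_effective (m : HeightOneSpectrum R →₀ ℕ) :
    divisorClass A (effective m) =
      Additive.ofMul (ClassGroup.mk0 (extendIdeal A (idealHom m).toMul)) := by
  have h : (divisorClass (R := R) A).comp effective =
      (MonoidHom.toAdditive (ClassGroup.mk0.comp (extendIdeal (R := R) A))).comp idealHom := by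
    refine Finsupp.addHom_ext fun v n => ?_
    have hp : extendIdeal A (idealHom (Finsupp.single v n)).toMul =
        extendIdeal A ⟨v.asIdeal, mem_nonZeroDivisors_of_ne_zero v.ne_bot⟩ ^ n := by
      rw [← map_pow]
      exact congrArg _ (Subtype.ext (by rw [idealHom_single]; rfl))
    simp [effective, divisorClass_single, hp]
  exact DFunLike.congr_fun h m

theorem divisorClass_divisor (K : Type*) [Field K] [Algebra R K] [IsFractionRing R K]
    (x : Additive Kˣ) : divisorClass A (divisor K x : HeightOneSpectrum R →₀ ℤ) = 0 := by
  have key : ∀ (a : R) (y : Kˣ), algebraMap R K a = y →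
      divisorClass A (divisor K (Additive.ofMul y) : HeightOneSpectrum R →₀ ℤ) = 0 := by
    intro a y hy
    obtain ⟨m, hm, hd⟩ := exists_divisor_eq_effective K hy
    rw [hd, divisorClass_effective, ofMul_eq_zero,
      ClassGroup.mk0_eq_one_iff (extendIdeal A (idealHom m).toMul).2]
    refine ⟨algebraMap R A a, ?_⟩
    rw [coe_extendIdeal, ← hm, Ideal.map_span, Set.image_singleton]
  obtain ⟨a, b, hb, hab⟩ := IsFractionRing.div_surjective (A := R) (x.toMul : K)
  have hb0 : algebraMap R K b ≠ 0 := IsFractionRing.to_map_ne_zero_of_mem_nonZeroDivisors hb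
  have ha0 : algebraMap R K a ≠ 0 := by
    intro h
    rw [h, zero_div] at hab
    exact x.toMul.ne_zero hab.symm
  have hx : x = Additive.ofMul (Units.mk0 _ ha0) - Additive.ofMul (Units.mk0 _ hb0) := by
    rw [← ofMul_div]
    refine Additive.toMul.injective (Units.ext ?_)
    simp [← hab]
  rw [hx, map_sub, map_sub, key a _ rfl, key b _ rfl, sub_zero]

end ClassGroup

section SIntegers

variable (S : Set (HeightOneSpectrum R)) (A : Type*) [CommRing A] [Algebra R A]
  (K : Type*) [Field K] [Algebra R K] [IsFractionRing R K] [Algebra A K] [IsScalarTower R A K]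

theorem exists_mem_iff_mem_of_finite [Finite (ClassGroup R)] (hS : S.Finite) :
    ∃ a : R, a ≠ 0 ∧ ∀ v : HeightOneSpectrum R, a ∈ v.asIdeal ↔ v ∈ S := by
  classical
  have h0 : ∏ v ∈ hS.toFinset, v.asIdeal ≠ 0 := Finset.prod_ne_zero_iff.mpr fun v _ => v.ne_bot
  have hp := mem_nonZeroDivisors_of_ne_zero (pow_ne_zero (Nat.card (ClassGroup R)) h0)
  have h1 : ClassGroup.mk0 (⟨_, hp⟩ : (Ideal R)⁰) = 1 := by
    have : (⟨_, hp⟩ : (Ideal R)⁰) =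
        ⟨_, mem_nonZeroDivisors_of_ne_zero h0⟩ ^ Nat.card (ClassGroup R) := rfl
    rw [this, map_pow, pow_card_eq_one']
  obtain ⟨a, ha⟩ := (ClassGroup.mk0_eq_one_iff hp).mp h1
  have ha' : (∏ v ∈ hS.toFinset, v.asIdeal) ^ Nat.card (ClassGroup R) = Ideal.span {a} := ha
  refine ⟨a, ?_, fun v => ?_⟩
  · rintro rfl
    exact pow_ne_zero (Nat.card (ClassGroup R)) h0 (by rw [ha']; simp)
  · rw [← Ideal.dvd_span_singleton, ← ha', Prime.dvd_pow_iff_dvd v.prime Nat.card_pos.ne',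
      Prime.dvd_finsetProd_iff v.prime]
    constructor
    · rintro ⟨w, hw, hd⟩
      rw [eq_of_asIdeal_dvd hd]
      exact hS.mem_toFinset.mp hw
    · exact fun hv => ⟨v, hS.mem_toFinset.mpr hv, dvd_rfl⟩

variable {S A K} in
theorem isLocalization_away_of_mem_iff [FaithfulSMul A K] (hS : S.Finite)
    (hA : ∀ x : K, (∀ v : HeightOneSpectrum R, v ∉ S → v.valuation K x ≤ 1) →
      x ∈ Set.range (algebraMap A K))
    (hA' : ∀ (x : A) (v : HeightOneSpectrum R), v ∉ S → v.valuation K (algebraMap A K x) ≤ 1)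
    {a : R} (ha : a ≠ 0) (haS : ∀ v : HeightOneSpectrum R, a ∈ v.asIdeal ↔ v ∈ S) :
    IsLocalization.Away a A := by
  have hinj := FaithfulSMul.algebraMap_injective A K
  have ha0 : algebraMap R K a ≠ 0 := by
    simpa using ha
  have hmap : ∀ r : R, algebraMap A K (algebraMap R A r) = algebraMap R K r := fun r =>
    (IsScalarTower.algebraMap_apply R A K r).symm
  refine IsLocalization.Away.mk a ?_ ?_ ?_
  · have hle : ∀ v : HeightOneSpectrum R, v ∉ S → v.valuation K (algebraMap R K a)⁻¹ ≤ 1 := by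
      intro v hv
      rw [map_inv₀, (valuation_eq_one_iff_notMem v).mpr (mt (haS v).mp hv), inv_one]
    obtain ⟨y, hy⟩ := hA _ hle
    refine IsUnit.of_mul_eq_one y (hinj ?_)
    rw [map_mul, hmap, hy, mul_inv_cancel₀ ha0, map_one]
  · intro x
    by_cases hx : algebraMap A K x = 0
    · exact ⟨0, 0, hinj (by simp [hx])⟩
    let n := ∑ v ∈ hS.toFinset, (log (v.valuation K (algebraMap A K x))).natAbs
    have hle : ∀ v : HeightOneSpectrum R,
        v.valuation K (algebraMap A K x * algebraMap R K a ^ n) ≤ 1 := by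
      intro v
      rw [map_mul, map_pow, valuation_of_algebraMap]
      by_cases hv : v ∈ S
      · have h1 : v.intValuation a ≤ exp (-1 : ℤ) := by
          simpa using (intValuation_le_pow_iff_mem v a 1).mpr (by simpa using (haS v).mpr hv)
        have h2 : v.valuation K (algebraMap A K x) ≠ 0 := (Valuation.ne_zero_iff _).mpr hx
        have h3 : (log (v.valuation K (algebraMap A K x))).natAbs ≤ n :=
          Finset.single_le_sum
            (f := fun v : HeightOneSpectrum R => (log (v.valuation K (algebraMap A K x))).natAbs)
            (fun _ _ => Nat.zero_le _) (hS.mem_toFinset.mpr hv)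
        calc _ ≤ exp (log (v.valuation K (algebraMap A K x))) * exp (-1 : ℤ) ^ n := by
              rw [exp_log h2]
              gcongr
          _ = exp (log (v.valuation K (algebraMap A K x)) - n) := by
              rw [← exp_nsmul, ← exp_add]
              simp [sub_eq_add_neg]
          _ ≤ 1 := by
              rw [← exp_zero, exp_le_exp]
              lia
      · exact mul_le_one' (hA' x v hv) (pow_le_one' (v.intValuation_le_one a) n)
    obtain ⟨b, hb⟩ := mem_integers_of_valuation_le_one K _ hle
    exact ⟨n, b, hinj (by rw [map_mul, map_pow, hmap, hmap, hb])⟩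
  · intro b c hbc
    refine ⟨0, ?_⟩
    have := congrArg (algebraMap A K) hbc
    rw [hmap, hmap] at this
    rw [IsFractionRing.injective R K this]

variable {S A K} in
theorem valuation_eq_of_map_eq_span [FaithfulSMul A K]
    (hA : ∀ (x : A) (v : HeightOneSpectrum R), v ∉ S → v.valuation K (algebraMap A K x) ≤ 1)
    {m : HeightOneSpectrum R →₀ ℕ} {y : A} (hy : y ≠ 0)
    (h : ((idealHom m).toMul : Ideal R).map (algebraMap R A) = Ideal.span {y})
    {v : HeightOneSpectrum R} (hv : v ∉ S) :
    v.valuation K (algebraMap A K y) = exp (-(m v : ℤ)) := by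
  have hmap : ∀ r : R, algebraMap A K (algebraMap R A r) = algebraMap R K r := fun r =>
    (IsScalarTower.algebraMap_apply R A K r).symm
  apply le_antisymm
  · have key : ∀ z ∈ ((idealHom m).toMul : Ideal R).map (algebraMap R A),
        v.valuation K (algebraMap A K z) ≤ exp (-(m v : ℤ)) := by
      intro z hz
      induction hz using Submodule.span_induction with
      | mem z hz =>
        obtain ⟨r, hr, rfl⟩ := hz
        rw [hmap, valuation_of_algebraMap, intValuation_le_pow_iff_mem]
        exact Ideal.le_of_dvd (pow_dvd_of_le_emultiplicity (emultiplicity_idealHom v m).ge) hr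
      | zero => simp
      | add z w _ _ hz hw =>
        rw [map_add]
        exact Valuation.map_add_le _ hz hw
      | smul c z _ hz =>
        rw [smul_eq_mul, map_mul, map_mul]
        exact mul_le_of_le_one_of_le (hA c v hv) hz
    exact key y (h ▸ Ideal.mem_span_singleton_self y)
  · have hnd : ¬ v.asIdeal ^ (m v + 1) ∣ ((idealHom m).toMul : Ideal R) := by
      rw [pow_dvd_iff_le_emultiplicity, emultiplicity_idealHom]
      exact_mod_cast (Nat.lt_succ_self _).not_ge
    rw [Ideal.dvd_iff_le, SetLike.not_le_iff_exists] at hnd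
    obtain ⟨r, hr, hrv⟩ := hnd
    obtain ⟨t, ht⟩ := Ideal.mem_span_singleton'.mp (h ▸ Ideal.mem_map_of_mem (algebraMap R A) hr)
    have hvr : v.valuation K (algebraMap R K r) = v.intValuation r := valuation_of_algebraMap v r
    rw [← intValuation_le_pow_iff_mem, not_le, ← hvr, ← hmap, ← ht, map_mul, map_mul] at hrv
    have h0 : v.valuation K (algebraMap A K y) ≠ 0 := by
      simpa using hy
    have := hrv.trans_le (mul_le_of_le_one_left' (hA t v hv))
    rw [← exp_log h0, exp_lt_exp] at this
    rw [← exp_log h0, exp_le_exp]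
    push_cast at this
    linarith

variable {A K} [IsDedekindDomain A] [FaithfulSMul R A]

theorem divisorClass_surjective {a : R} [IsLocalization.Away a A] :
    Function.Surjective (divisorClass (R := R) A) := by
  intro c
  obtain ⟨I, hI⟩ := ClassGroup.mk0_surjective c.toMul
  have hmc := IsLocalization.map_under (Submonoid.powers a) A (I : Ideal A)
  obtain ⟨m, hm⟩ := exists_idealHom_eq (I := (I : Ideal A).under R) fun h => by
    rw [h] at hmc
    exact nonZeroDivisors.coe_ne_zero I (by rw [← hmc]; exact Ideal.map_bot)
  refine ⟨effective m, ?_⟩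
  rw [divisorClass_effective]
  have : extendIdeal A (idealHom m).toMul = I := Subtype.ext (by rw [coe_extendIdeal, hm, hmc])
  rw [this, hI, ofMul_toMul]

theorem divisorClass_eq_zero_iff [FaithfulSMul A K]
    (hA : ∀ (x : A) (v : HeightOneSpectrum R), v ∉ S → v.valuation K (algebraMap A K x) ≤ 1)
    {a : R} [IsLocalization.Away a A] (haS : ∀ v : HeightOneSpectrum R, v ∈ S → a ∈ v.asIdeal)
    (n : HeightOneSpectrum R →₀ ℤ) :
    divisorClass A n = 0 ↔
      ∃ x : Additive Kˣ, ∀ v : HeightOneSpectrum R, v ∉ S → n v = divisor K x v := by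
  constructor
  · intro hn
    obtain ⟨p, q, hpq⟩ : ∃ p q, n = effective p - effective q :=
      ⟨n.mapRange Int.toNat rfl, (-n).mapRange Int.toNat rfl, by ext v; simp⟩
    obtain ⟨b, hb, hb0⟩ := Submodule.exists_mem_ne_zero_of_ne_bot
      (nonZeroDivisors.coe_ne_zero (idealHom q).toMul)
    have hbK : algebraMap R K b ≠ 0 := by simpa using hb0
    obtain ⟨I, hI⟩ := Ideal.dvd_span_singleton.mpr hb
    have hI0 : I ≠ 0 := by
      rintro rfl
      rw [mul_zero, Ideal.zero_eq_bot, Ideal.span_singleton_eq_bot] at hI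
      exact hb0 hI
    obtain ⟨r, rfl⟩ := exists_idealHom_eq hI0
    have hdb : ∀ v, divisor K (Additive.ofMul (Units.mk0 _ hbK)) v = (q v + r v : ℤ) := by
      intro v
      rw [← Submonoid.coe_mul, ← toMul_add, ← map_add] at hI
      rw [divisor_apply, toMul_ofMul, Units.val_mk0, valuation_of_algebraMap,
        intValuation_of_span_eq_idealHom hI, log_exp, neg_neg]
      simp
    have hpr : n + divisor K (Additive.ofMul (Units.mk0 _ hbK)) = effective (p + r) := by
      ext v
      rw [Finsupp.add_apply, hdb, hpq]
      simp
      ring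
    have hcl := congrArg (divisorClass A) hpr
    rw [map_add, hn, divisorClass_divisor, zero_add, divisorClass_effective, eq_comm,
      ofMul_eq_zero, ClassGroup.mk0_eq_one_iff (extendIdeal A _).2] at hcl
    obtain ⟨y, hy⟩ := hcl
    have hy' : ((idealHom (p + r)).toMul : Ideal R).map (algebraMap R A) = Ideal.span {y} := hy
    have hy0 : y ≠ 0 := by
      rintro rfl
      exact nonZeroDivisors.coe_ne_zero (extendIdeal A (idealHom (p + r)).toMul)
        (by rw [coe_extendIdeal, hy']; simp)
    have hyK : algebraMap A K y ≠ 0 := by simpa using hy0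
    refine ⟨Additive.ofMul (Units.mk0 _ hyK) - Additive.ofMul (Units.mk0 _ hbK), fun v hv => ?_⟩
    rw [map_sub, Finsupp.sub_apply, hdb, divisor_apply, toMul_ofMul, Units.val_mk0,
      valuation_eq_of_map_eq_span hA hy0 hy' hv, log_exp, hpq]
    simp
  · rintro ⟨x, hx⟩
    have hsum : divisorClass A (n - divisor K x) = 0 := by
      rw [← Finsupp.sum_single (n - divisor K x), Finsupp.sum, map_sum]
      refine Finset.sum_eq_zero fun v hv => ?_
      have hvS : v ∈ S := by
        by_contra hc
        exact Finsupp.mem_support_iff.mp hv (by rw [Finsupp.sub_apply, hx v hc, sub_self])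
      rw [divisorClass_single, (ofMul_eq_zero (A := ClassGroup A)).mpr, smul_zero]
      rw [ClassGroup.mk0_eq_one_iff (extendIdeal A _).2, coe_extendIdeal,
        Ideal.eq_top_of_isUnit_mem _ (Ideal.mem_map_of_mem (algebraMap R A) (haS v hvS))
          (IsLocalization.Away.algebraMap_isUnit a)]
      exact top_isPrincipal
    rwa [map_sub, divisorClass_divisor, sub_zero] at hsum

end SIntegers

section Equiv

variable {K : Type*} [Field K] [Algebra R K] [IsFractionRing R K]

theorem valuation_equivOfRingEquiv {σ : R ≃+* R} {τ : K ≃+* K}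
    (h : ∀ r, algebraMap R K (σ r) = τ (algebraMap R K r)) (v : HeightOneSpectrum R) (x : K) :
    (equivOfRingEquiv σ v).valuation K (τ x) = v.valuation K x := by
  have key : ∀ r, (equivOfRingEquiv σ v).intValuation (σ r) = v.intValuation r := by
    intro r
    have hle : ∀ n : ℕ, (equivOfRingEquiv σ v).intValuation (σ r) ≤ exp (-(n : ℤ)) ↔
        v.intValuation r ≤ exp (-(n : ℤ)) := by
      intro n
      have : (equivOfRingEquiv σ v).asIdeal = v.asIdeal.map σ := (Ideal.map_symm σ.symm).symm
      rw [intValuation_le_pow_iff_mem, intValuation_le_pow_iff_mem, this, ← Ideal.map_pow,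
        Ideal.mem_map_of_equiv]
      simp
    by_cases hr : r = 0
    · simp [hr]
    · have hr' : σ r ≠ 0 := by simpa using hr
      rw [intValuation_if_neg _ hr, intValuation_if_neg _ hr'] at *
      exact le_antisymm ((hle _).mpr le_rfl) ((hle _).mp le_rfl)
  obtain ⟨a, b, hb, rfl⟩ := IsFractionRing.div_surjective (A := R) x
  rw [map_div₀ τ, ← h, ← h, map_div₀, map_div₀]
  simp only [valuation_of_algebraMap, key]

end Equiv

end IsDedekindDomain.HeightOneSpectrum

namespace NumberField

open IsDedekindDomain HeightOneSpectrum

section Places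

variable (F : Type*) [Field F]

/-- The free abelian group on the set of all places of `F`. -/
abbrev PlaceDivisor := (InfinitePlace F ⊕ HeightOneSpectrum (𝓞 F)) →₀ ℤ

/-- The non-archimedean part of a divisor. -/
noncomputable def finitePart : PlaceDivisor F →+ (HeightOneSpectrum (𝓞 F) →₀ ℤ) :=
  Finsupp.comapDomain.addMonoidHom Sum.inr_injective

@[simp]
theorem finitePart_apply (n : PlaceDivisor F) (v : HeightOneSpectrum (𝓞 F)) :
    finitePart F n v = n (Sum.inr v) :=
  rfl

/-- Extension by zero of divisors supported on `S` and the archimedean places. -/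
noncomputable def extendDivisor (S : Set (HeightOneSpectrum (𝓞 F))) :
    ((InfinitePlace F ⊕ {v // v ∈ S}) →₀ ℤ) →+ PlaceDivisor F :=
  Finsupp.mapDomain.addMonoidHom (Sum.map id Subtype.val)

theorem extendDivisor_injective (S : Set (HeightOneSpectrum (𝓞 F))) :
    Function.Injective (extendDivisor F S) :=
  Finsupp.mapDomain_injective (Sum.map_injective.mpr ⟨Function.injective_id, Subtype.val_injective⟩)

theorem exists_extendDivisor_eq_iff (S : Set (HeightOneSpectrum (𝓞 F))) (n : PlaceDivisor F) :
    (∃ p, extendDivisor F S p = n) ↔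
      ∀ v : HeightOneSpectrum (𝓞 F), v ∉ S → n (Sum.inr v) = 0 := by
  have hinj : Function.Injective (Sum.map (id : InfinitePlace F → _) (Subtype.val : S → _)) :=
    Sum.map_injective.mpr ⟨Function.injective_id, Subtype.val_injective⟩
  constructor
  · rintro ⟨p, rfl⟩ v hv
    refine Finsupp.mapDomain_of_notMem_range _ _ ?_
    rintro ⟨_ | w, hw⟩
    · simp at hw
    · exact hv (Sum.inr_injective hw ▸ w.2)
  · intro h
    refine ⟨n.comapDomain _ hinj.injOn, Finsupp.mapDomain_comapDomain _ hinj _ ?_⟩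
    rintro (w | v) hn
    · exact ⟨Sum.inl w, rfl⟩
    · by_cases hv : v ∈ S
      · exact ⟨Sum.inr ⟨v, hv⟩, rfl⟩
      · exact absurd (h v hv) (Finsupp.mem_support_iff.mp hn)

variable [NumberField F]

/-- The divisor of an element of `Fˣ`, with zero archimedean components. -/
noncomputable def placeDivisor : Additive Fˣ →+ PlaceDivisor F :=
  (Finsupp.mapDomain.addMonoidHom Sum.inr).comp (divisor F)

theorem placeDivisor_inl (x : Additive Fˣ) (w : InfinitePlace F) :
    placeDivisor F x (Sum.inl w) = 0 :=
  Finsupp.mapDomain_of_notMem_range _ _ (by simp)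

theorem placeDivisor_inr (x : Additive Fˣ) (v : HeightOneSpectrum (𝓞 F)) :
    placeDivisor F x (Sum.inr v) = divisor F x v :=
  Finsupp.mapDomain_apply Sum.inr_injective _ _

theorem finite_ker_of_eq_placeDivisor {G : Type*} [Group G]
    [Module (MonoidAlgebra ℤ G) (Additive Fˣ)] [Module (MonoidAlgebra ℤ G) (PlaceDivisor F)]
    (φ : Additive Fˣ →ₗ[MonoidAlgebra ℤ G] PlaceDivisor F) (hφ : ∀ x, φ x = placeDivisor F x) :
    Module.Finite (MonoidAlgebra ℤ G) (LinearMap.ker φ) := by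
  have hval : ∀ x : Additive Fˣ, φ x = 0 ↔
      ∀ v : HeightOneSpectrum (𝓞 F), v.valuation F (x.toMul : F) = 1 := by
    intro x
    simp_rw [hφ, ← divisor_eq_zero_iff, ← placeDivisor_inr]
    constructor
    · intro h v
      rw [h, Finsupp.zero_apply]
    · intro h
      ext (w | v)
      · exact placeDivisor_inl F x w
      · exact h v
  let f : Additive (𝓞 F)ˣ →+ Additive Fˣ := (Units.map (algebraMap (𝓞 F) F).toMonoidHom).toAdditive
  have hf : ∀ u, f u ∈ LinearMap.ker φ := by
    intro u
    refine (hval _).mpr fun v => ?_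
    have h : v.valuation F (algebraMap (𝓞 F) F u.toMul) = 1 := by
      rw [valuation_eq_one_iff_notMem]
      exact fun hu => v.isPrime.ne_top (Ideal.eq_top_of_isUnit_mem _ hu u.toMul.isUnit)
    exact h
  let f' : Additive (𝓞 F)ˣ →+ LinearMap.ker φ :=
    .mk' (fun u => ⟨f u, hf u⟩) fun u v => Subtype.ext (map_add f u v)
  refine .of_addMonoidHom_surjective f' ?_
  rintro ⟨x, hx⟩
  have hx := (hval x).mp hx
  obtain ⟨a, ha⟩ := mem_integers_of_valuation_le_one F (x.toMul : F) fun v => (hx v).le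
  obtain ⟨b, hb⟩ := mem_integers_of_valuation_le_one F ((x.toMul : F)⁻¹) fun v => by
    rw [map_inv₀, hx v, inv_one]
  have hab : a * b = 1 := by
    refine IsFractionRing.injective (𝓞 F) F ?_
    rw [map_mul, ha, hb, mul_inv_cancel₀ x.toMul.ne_zero, map_one]
  exact ⟨Additive.ofMul ⟨a, b, hab, mul_comm a b ▸ hab⟩, Subtype.ext (Units.ext ha)⟩

theorem finite_quotient_of_eq_placeDivisor {G : Type*} [Group G]
    [Module (MonoidAlgebra ℤ G) (Additive Fˣ)] [Module (MonoidAlgebra ℤ G) (PlaceDivisor F)]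
    (φ : Additive Fˣ →ₗ[MonoidAlgebra ℤ G] PlaceDivisor F) (hφ : ∀ x, φ x = placeDivisor F x) :
    Module.Finite (MonoidAlgebra ℤ G) (PlaceDivisor F ⧸ LinearMap.range φ) := by
  have : IsLocalization.Away (1 : 𝓞 F) (𝓞 F) :=
    IsLocalization.away_of_isUnit_of_bijective _ isUnit_one Function.bijective_id
  obtain ⟨s, hs⟩ := (divisorClass_surjective (R := 𝓞 F) (A := 𝓞 F) (a := 1)).hasRightInverse
  let f : (InfinitePlace F →₀ ℤ) × (Additive (ClassGroup (𝓞 F)) →₀ ℤ) →+ PlaceDivisor F :=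
    (Finsupp.mapDomain.addMonoidHom Sum.inl).coprod
      (Finsupp.liftAddHom fun c => zmultiplesHom _ ((s c).mapDomain Sum.inr))
  have : Finite (Additive (ClassGroup (𝓞 F))) := inferInstanceAs (Finite (ClassGroup (𝓞 F)))
  refine .of_addMonoidHom_surjective ((LinearMap.range φ).mkQ.toAddMonoidHom.comp f) fun q => ?_
  obtain ⟨n, rfl⟩ := Submodule.Quotient.mk_surjective _ q
  let c := divisorClass (𝓞 F) (finitePart F n)
  have hn : divisorClass (𝓞 F) (finitePart F n - s c) = 0 := by
    rw [map_sub, hs, sub_self]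
  obtain ⟨x, hx⟩ := (divisorClass_eq_zero_iff (K := F) ∅ (fun x v _ => v.valuation_le_one x)
    (a := 1) (by simp) _).mp hn
  refine ⟨(n.comapDomain Sum.inl Sum.inl_injective.injOn, Finsupp.single c 1), ?_⟩
  refine (Submodule.Quotient.eq _).mpr ⟨-x, ?_⟩
  rw [map_neg, hφ]
  ext (w | v)
  · simp [f, placeDivisor_inl, Finsupp.mapDomain_apply Sum.inl_injective,
      Finsupp.mapDomain_of_notMem_range]
  · have := hx v (by simp)
    simp only [Finsupp.sub_apply, finitePart_apply] at this
    simp [f, placeDivisor_inr, Finsupp.mapDomain_apply Sum.inr_injective,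
      Finsupp.mapDomain_of_notMem_range, ← this, -divisor_apply]

end Places

section Galois

variable {K F : Type*} [Field K] [Field F] [Algebra K F]

/-- The action of an automorphism on the non-archimedean places. -/
noncomputable def galFinitePlace (σ : F ≃ₐ[K] F) : Equiv.Perm (HeightOneSpectrum (𝓞 F)) :=
  equivOfRingEquiv (RingOfIntegers.mapRingEquiv σ.toRingEquiv)

theorem mem_galFinitePlace (σ : F ≃ₐ[K] F) (v : HeightOneSpectrum (𝓞 F)) (x : 𝓞 F) :
    x ∈ (galFinitePlace σ v).asIdeal ↔
      (RingOfIntegers.mapRingEquiv σ.toRingEquiv).symm x ∈ v.asIdeal :=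
  Iff.rfl

theorem image_galFinitePlace (σ : F ≃ₐ[K] F) (v : HeightOneSpectrum (𝓞 F)) :
    algebraMap (𝓞 F) F '' ((galFinitePlace σ v).asIdeal : Set (𝓞 F)) =
      σ '' (algebraMap (𝓞 F) F '' (v.asIdeal : Set (𝓞 F))) := by
  ext x
  constructor
  · rintro ⟨y, hy, rfl⟩
    exact ⟨_, ⟨_, (mem_galFinitePlace σ v y).mp hy, rfl⟩, σ.apply_symm_apply _⟩
  · rintro ⟨_, ⟨y, hy, rfl⟩, rfl⟩
    refine ⟨RingOfIntegers.mapRingEquiv σ.toRingEquiv y, ?_, rfl⟩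
    rw [SetLike.mem_coe, mem_galFinitePlace, RingEquiv.symm_apply_apply]
    exact hy

theorem eq_galFinitePlace {σ : F ≃ₐ[K] F} {v w : HeightOneSpectrum (𝓞 F)}
    (h : algebraMap (𝓞 F) F '' (w.asIdeal : Set (𝓞 F)) =
      σ '' (algebraMap (𝓞 F) F '' (v.asIdeal : Set (𝓞 F)))) : w = galFinitePlace σ v := by
  rw [← image_galFinitePlace] at h
  exact HeightOneSpectrum.ext (SetLike.coe_injective
    ((FaithfulSMul.algebraMap_injective (𝓞 F) F).image_injective h))

theorem galFinitePlace_mul (σ τ : F ≃ₐ[K] F) :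
    galFinitePlace (σ * τ) = galFinitePlace σ * galFinitePlace τ :=
  Equiv.ext fun _ => HeightOneSpectrum.ext (Ideal.ext fun _ => Iff.rfl)

theorem galFinitePlace_one : galFinitePlace (1 : F ≃ₐ[K] F) = 1 :=
  Equiv.ext fun _ => HeightOneSpectrum.ext (Ideal.ext fun _ => Iff.rfl)

/-- The action of an automorphism on all places. -/
noncomputable def galPlace : (F ≃ₐ[K] F) →*
    Equiv.Perm (InfinitePlace F ⊕ HeightOneSpectrum (𝓞 F)) where
  toFun σ := Equiv.sumCongr (MulAction.toPerm σ) (galFinitePlace σ)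
  map_one' := by
    ext (w | v)
    · simp
    · simp [galFinitePlace_one]
  map_mul' σ τ := by
    ext (w | v)
    · simp [mul_smul]
    · simp [galFinitePlace_mul]

/-- The Galois action on divisors. -/
noncomputable def galDivisor : (F ≃ₐ[K] F) →* AddMonoid.End (PlaceDivisor F) where
  toFun σ := Finsupp.mapDomain.addMonoidHom (galPlace σ)
  map_one' := by
    rw [map_one]
    refine DFunLike.ext _ _ fun n => ?_
    exact Finsupp.mapDomain_id (v := n)
  map_mul' σ τ := by
    rw [map_mul]
    refine DFunLike.ext _ _ fun n => ?_
    exact Finsupp.mapDomain_comp (v := n) (f := galPlace τ) (g := galPlace σ)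

variable (K F) in
/-- The Galois action on `Fˣ`. -/
def galUnits : (F ≃ₐ[K] F) →* AddMonoid.End (Additive Fˣ) where
  toFun σ := (Units.map (σ : F →* F)).toAdditive
  map_one' := rfl
  map_mul' _ _ := rfl

variable {S : Set (HeightOneSpectrum (𝓞 F))}

theorem mem_of_galFinitePlace_notMem {σ : F ≃ₐ[K] F} (hσ : ∀ v ∈ S, galFinitePlace σ v ∈ S)
    {p : HeightOneSpectrum (𝓞 F) → Prop} (hp : ∀ v, v ∉ S → p (galFinitePlace σ v)) :
    ∀ v, v ∉ S → p v := by
  intro v hv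
  obtain ⟨v, rfl⟩ := (galFinitePlace σ).surjective v
  exact hp v (mt (hσ v) hv)

variable [NumberField F]

theorem valuation_galFinitePlace (σ : F ≃ₐ[K] F) (v : HeightOneSpectrum (𝓞 F)) (x : F) :
    (galFinitePlace σ v).valuation F (σ x) = v.valuation F x :=
  valuation_equivOfRingEquiv (τ := σ.toRingEquiv) (fun _ => rfl) v x

theorem placeDivisor_galUnits (σ : F ≃ₐ[K] F) (x : Additive Fˣ) :
    placeDivisor F (galUnits K F σ x) = galDivisor σ (placeDivisor F x) := by
  ext p
  obtain ⟨p, rfl⟩ := (galPlace σ).surjective p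
  refine Eq.trans ?_ (Finsupp.mapDomain_apply (galPlace σ).injective _ _).symm
  rcases p with w | v
  · exact (placeDivisor_inl F _ _).trans (placeDivisor_inl F _ _).symm
  · refine (placeDivisor_inr F _ (galFinitePlace σ v)).trans
      (Eq.trans ?_ (placeDivisor_inr F _ _).symm)
    rw [divisor_apply, divisor_apply]
    exact congrArg (fun y => -WithZero.log y) (valuation_galFinitePlace σ v (x.toMul : F))

theorem galUnits_mem_unit {σ : F ≃ₐ[K] F} (hσ : ∀ v ∈ S, galFinitePlace σ v ∈ S) (u : S.unit F) :
    (Units.map (σ : F →* F) u : Fˣ) ∈ S.unit F := by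
  refine mem_of_galFinitePlace_notMem hσ fun v hv => ?_
  exact (valuation_galFinitePlace σ v _).trans (u.2 v hv)

/-- The endomorphism of the ring of `S`-integers induced by an automorphism preserving `S`. -/
noncomputable def galInteger {σ : F ≃ₐ[K] F} (hσ : ∀ v ∈ S, galFinitePlace σ v ∈ S) :
    S.integer F →+* S.integer F :=
  ((σ : F →+* F).comp (S.integer F).val.toRingHom).codRestrict (S.integer F) fun x =>
    mem_of_galFinitePlace_notMem hσ fun v hv => (valuation_galFinitePlace σ v _).trans_le (x.2 v hv)

theorem galInteger_mem_map {σ : F ≃ₐ[K] F} (hσ : ∀ v ∈ S, galFinitePlace σ v ∈ S)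
    (v : HeightOneSpectrum (𝓞 F)) {x : S.integer F}
    (hx : x ∈ v.asIdeal.map (algebraMap (𝓞 F) (S.integer F))) :
    galInteger hσ x ∈ (galFinitePlace σ v).asIdeal.map (algebraMap (𝓞 F) (S.integer F)) := by
  have h := Ideal.mem_map_of_mem (galInteger hσ) hx
  rw [Ideal.map_map] at h
  have hc : (galInteger hσ).comp (algebraMap (𝓞 F) (S.integer F)) =
      (algebraMap (𝓞 F) (S.integer F)).comp
        (RingOfIntegers.mapRingEquiv σ.toRingEquiv : 𝓞 F →+* 𝓞 F) :=
    RingHom.ext fun _ => Subtype.ext rfl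
  rw [hc, ← Ideal.map_map] at h
  refine Ideal.map_mono (Ideal.map_le_iff_le_comap.mpr fun y hy => ?_) h
  rw [Ideal.mem_comap, mem_galFinitePlace]
  simpa using hy

theorem image_map_galFinitePlace {σ : F ≃ₐ[K] F} (hσ : ∀ v ∈ S, galFinitePlace σ v ∈ S)
    (hσ' : ∀ v ∈ S, galFinitePlace σ⁻¹ v ∈ S) (v : HeightOneSpectrum (𝓞 F)) :
    (fun x : S.integer F => (x : F)) ''
        ((galFinitePlace σ v).asIdeal.map (algebraMap (𝓞 F) (S.integer F)) : Set (S.integer F)) =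
      σ '' ((fun x : S.integer F => (x : F)) ''
        (v.asIdeal.map (algebraMap (𝓞 F) (S.integer F)) : Set (S.integer F))) := by
  ext y
  constructor
  · rintro ⟨x, hx, rfl⟩
    have h := galInteger_mem_map hσ' _ hx
    rw [← Equiv.Perm.mul_apply, ← galFinitePlace_mul, inv_mul_cancel, galFinitePlace_one] at h
    exact ⟨_, ⟨_, h, rfl⟩, σ.apply_symm_apply _⟩
  · rintro ⟨_, ⟨x, hx, rfl⟩, rfl⟩
    exact ⟨_, galInteger_mem_map hσ v hx, rfl⟩

end Galois

/-- The Euler characteristic of the `S`-units, the places in `S` and the `S`-class group, in terms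
of modules which do not depend on `S`. -/
theorem cls_sub_cls_unit_add_cls_classGroup {K F G : Type} [Field K] [Field F] [NumberField F]
    [Algebra K F] [Group G] [Finite G] (iso : G ≃* (F ≃ₐ[K] F))
    [Module (MonoidAlgebra ℤ G) (Additive Fˣ)] [Module (MonoidAlgebra ℤ G) (PlaceDivisor F)]
    (hM : ∀ (g : G) (x : Additive Fˣ),
      (MonoidAlgebra.single g (1 : ℤ) : MonoidAlgebra ℤ G) • x = galUnits K F (iso g) x)
    (hN : ∀ (g : G) (n : PlaceDivisor F),
      (MonoidAlgebra.single g (1 : ℤ) : MonoidAlgebra ℤ G) • n = galDivisor (iso g) n)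
    (φ : Additive Fˣ →ₗ[MonoidAlgebra ℤ G] PlaceDivisor F) (hφ : ∀ x, φ x = placeDivisor F x)
    (S : Set (HeightOneSpectrum (𝓞 F))) (hS : S.Finite) [IsDedekindDomain (S.integer F)]
    (act : G → {v // v ∈ S} → {v // v ∈ S})
    (hact : ∀ (g : G) (v : {v // v ∈ S}),
      algebraMap (𝓞 F) F '' ((act g v : HeightOneSpectrum (𝓞 F)).asIdeal : Set (𝓞 F)) =
        iso g '' (algebraMap (𝓞 F) F '' ((v : HeightOneSpectrum (𝓞 F)).asIdeal : Set (𝓞 F))))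
    [Module (MonoidAlgebra ℤ G) ((InfinitePlace F ⊕ {v // v ∈ S}) →₀ ℤ)]
    (hP : ∀ (g : G) (x : (InfinitePlace F ⊕ {v // v ∈ S}) →₀ ℤ),
      (MonoidAlgebra.single g (1 : ℤ) : MonoidAlgebra ℤ G) • x =
        Finsupp.mapDomain (Sum.map (fun w => iso g • w) (act g)) x)
    [Module (MonoidAlgebra ℤ G) (Additive (S.unit F))]
    (hU : ∀ (g : G) (u v : S.unit F), ((v : Fˣ) : F) = iso g ((u : Fˣ) : F) →
      (MonoidAlgebra.single g (1 : ℤ) : MonoidAlgebra ℤ G) • Additive.ofMul u = Additive.ofMul v)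
    [Module (MonoidAlgebra ℤ G) (Additive (ClassGroup (S.integer F)))]
    (hC : ∀ (g : G) (I J : (Ideal (S.integer F))⁰),
      ((fun x : S.integer F => (x : F)) '' ((J : Ideal (S.integer F)) : Set (S.integer F)) =
        iso g '' ((fun x : S.integer F => (x : F)) ''
          ((I : Ideal (S.integer F)) : Set (S.integer F)))) →
      (MonoidAlgebra.single g (1 : ℤ) : MonoidAlgebra ℤ G) •
          Additive.ofMul (ClassGroup.mk0 I) = Additive.ofMul (ClassGroup.mk0 J)) :
    G0.cls (MonoidAlgebra ℤ G) ((InfinitePlace F ⊕ {v // v ∈ S}) →₀ ℤ) -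
        G0.cls (MonoidAlgebra ℤ G) (Additive (S.unit F)) +
        G0.cls (MonoidAlgebra ℤ G) (Additive (ClassGroup (S.integer F))) =
      G0.cls (MonoidAlgebra ℤ G) (PlaceDivisor F ⧸ LinearMap.range φ) -
        G0.cls (MonoidAlgebra ℤ G) (LinearMap.ker φ) := by
  have hact' : ∀ g v, (act g v : HeightOneSpectrum (𝓞 F)) = galFinitePlace (iso g) v :=
    fun g v => eq_galFinitePlace (hact g v)
  have hstab : ∀ g, ∀ v ∈ S, galFinitePlace (iso g) v ∈ S :=
    fun g v hv => hact' g ⟨v, hv⟩ ▸ (act g ⟨v, hv⟩).2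
  have hstab' : ∀ g, ∀ v ∈ S, galFinitePlace (iso g)⁻¹ v ∈ S :=
    fun g => by rw [← map_inv]; exact hstab g⁻¹
  have : FaithfulSMul (𝓞 F) (S.integer F) := by
    refine (faithfulSMul_iff_algebraMap_injective _ _).mpr fun a b h => ?_
    exact FaithfulSMul.algebraMap_injective (𝓞 F) F (congrArg (S.integer F).val h)
  have hA : ∀ (x : S.integer F) (v : HeightOneSpectrum (𝓞 F)), v ∉ S →
      v.valuation F (algebraMap (S.integer F) F x) ≤ 1 := fun x => x.2
  obtain ⟨a, ha, haS⟩ := exists_mem_iff_mem_of_finite S hS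
  have : IsLocalization.Away a (S.integer F) :=
    isLocalization_away_of_mem_iff hS (fun x hx => ⟨⟨x, hx⟩, rfl⟩) hA ha haS
  have : IsNoetherianRing (MonoidAlgebra ℤ G) := isNoetherianRing_groupRing
  have : Finite {v // v ∈ S} := hS
  have : Module.Finite (MonoidAlgebra ℤ G) ((InfinitePlace F ⊕ {v // v ∈ S}) →₀ ℤ) :=
    .of_addMonoidHom_surjective (AddMonoidHom.id _) Function.surjective_id
  have := finite_ker_of_eq_placeDivisor F φ hφ
  have := finite_quotient_of_eq_placeDivisor F φ hφ
  let ι := equivariantLinearMap (G := G) (extendDivisor F S) fun g p => by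
    rw [hP, hN]
    refine (Finsupp.mapDomain_comp (v := p)).symm.trans (Eq.trans ?_ Finsupp.mapDomain_comp)
    congr 1
    ext1 (w | v)
    · rfl
    · exact congrArg Sum.inr (hact' g v)
  let j := equivariantLinearMap (G := G) (S.unit F).subtype.toAdditive fun g u => by
    rw [hM, ← ofMul_toMul u, hU g u.toMul ⟨_, galUnits_mem_unit (hstab g) u.toMul⟩ rfl]
    rfl
  let ψ := equivariantLinearMap (G := G)
      ((divisorClass (S.integer F)).comp (finitePart F)) fun g n => by
    rw [hN]
    induction n using Finsupp.induction_linear with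
    | zero => simp only [map_zero, smul_zero]
    | add f g hf hg => simp only [map_add, smul_add, hf, hg]
    | single p m =>
      have hgal : galDivisor (iso g) (Finsupp.single p m) = Finsupp.single (galPlace (iso g) p) m :=
        Finsupp.mapDomain_single
      rw [hgal]
      rcases p with w | v
      · have hl : ∀ w : InfinitePlace F, finitePart F (Finsupp.single (Sum.inl w) m) = 0 :=
          fun w => by ext v; simp
        rw [AddMonoidHom.comp_apply, AddMonoidHom.comp_apply, hl w, map_zero, smul_zero]
        exact (congrArg _ (hl _)).trans (map_zero _)
      · have hr : ∀ v : HeightOneSpectrum (𝓞 F),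
            finitePart F (Finsupp.single (Sum.inr v) m) = Finsupp.single v m := by
          intro v
          exact Finsupp.comapDomain_single _ _ _ _
        rw [AddMonoidHom.comp_apply, AddMonoidHom.comp_apply, hr v, divisorClass_single, smul_comm,
          hC g (extendIdeal (S.integer F)
              ⟨v.asIdeal, mem_nonZeroDivisors_of_ne_zero v.ne_bot⟩)
            (extendIdeal (S.integer F) ⟨(galFinitePlace (iso g) v).asIdeal,
              mem_nonZeroDivisors_of_ne_zero (galFinitePlace (iso g) v).ne_bot⟩)
            (image_map_galFinitePlace (hstab g) (hstab' g) v), ← divisorClass_single]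
        exact congrArg _ (hr _)
  have hι : ∀ n, n ∈ LinearMap.range ι ↔
      ∀ v : HeightOneSpectrum (𝓞 F), v ∉ S → n (Sum.inr v) = 0 :=
    exists_extendDivisor_eq_iff F S
  refine G0.euler_char φ ι j ψ (extendDivisor_injective F S) Subtype.val_injective ?_ ?_ ?_
  · intro c
    obtain ⟨n, rfl⟩ := divisorClass_surjective (R := 𝓞 F) (A := S.integer F) (a := a) c
    exact ⟨n.mapDomain Sum.inr, congrArg (divisorClass (S.integer F))
      (Finsupp.ext fun v => Finsupp.mapDomain_apply Sum.inr_injective _ _)⟩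
  · ext x
    rw [Submodule.mem_comap, hι, hφ]
    simp_rw [placeDivisor_inr, divisor_eq_zero_iff]
    constructor
    · rintro ⟨u, rfl⟩
      exact u.toMul.2
    · exact fun h => ⟨Additive.ofMul ⟨x.toMul, h⟩, rfl⟩
  · ext n
    have hn : n ∈ LinearMap.ker ψ ↔ _ :=
      divisorClass_eq_zero_iff (A := S.integer F) (K := F) S hA (fun v => (haS v).mpr)
        (finitePart F n)
    rw [hn, sup_comm, Submodule.mem_sup]
    constructor
    · rintro ⟨x, hx⟩
      refine ⟨φ x, ⟨x, rfl⟩, n - φ x, (hι _).mpr fun v hv => ?_, add_sub_cancel _ _⟩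
      rw [Finsupp.sub_apply, hφ, placeDivisor_inr, ← hx v hv, finitePart_apply, sub_self]
    · rintro ⟨_, ⟨x, rfl⟩, p, hp, rfl⟩
      refine ⟨x, fun v hv => ?_⟩
      rw [finitePart_apply, Finsupp.add_apply, (hι p).mp hp v hv, add_zero, hφ, placeDivisor_inr]

end NumberField

/-!
STATEMENT 10: Let F/K be a finite Galois extension of number fields with Galois group G,
and let S and S' be two finite G-stable sets of places of F, both containing all
archimedean places.  Then [ℤ[S']] − [O×_{F,S'}] + [Cl_{F,S'}] = [ℤ[S]] − [O×_{F,S}] + [Cl_{F,S}]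
in G₀(ℤ[G]).

Each set of places is formalized by its (finite, G-stable) set of non-archimedean places
together with all the archimedean places; the ℤ[G]-module structures are universally
quantified and pinned down by the stated pointwise characterizations.
-/
theorem stmt10
    (K F : Type) [Field K] [NumberField K] [Field F] [NumberField F] [Algebra K F]
    [IsGalois K F] (G : Type) [Group G] (iso : G ≃* (F ≃ₐ[K] F))
    -- a finite G-stable set S of places of F containing all archimedean places,
    -- given by its set Sf of non-archimedean places (the archimedean ones are always included)
    (Sf : Set (IsDedekindDomain.HeightOneSpectrum (𝓞 F))) (hSffin : Sf.Finite)
    [IsDedekindDomain (Sf.integer F)]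
    -- the G-action on the finite places in S (G-stability of S)
    (act : G → {v // v ∈ Sf} → {v // v ∈ Sf})
    (hact : ∀ (g : G) (v : {v // v ∈ Sf}),
      algebraMap (𝓞 F) F ''
          (((act g v : IsDedekindDomain.HeightOneSpectrum (𝓞 F))).asIdeal : Set (𝓞 F)) =
        iso g '' (algebraMap (𝓞 F) F ''
          ((v : IsDedekindDomain.HeightOneSpectrum (𝓞 F)).asIdeal : Set (𝓞 F))))
    -- the permutation module ℤ[S]
    [mS : Module (MonoidAlgebra ℤ G)
      ((NumberField.InfinitePlace F ⊕ {v // v ∈ Sf}) →₀ ℤ)]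
    (hmS : ∀ (g : G) (x : (NumberField.InfinitePlace F ⊕ {v // v ∈ Sf}) →₀ ℤ),
      (MonoidAlgebra.single g (1 : ℤ) : MonoidAlgebra ℤ G) • x =
        Finsupp.mapDomain (Sum.map (fun w => iso g • w) (act g)) x)
    -- the ℤ[G]-module of S-units O_{F,S}^×
    [mU : Module (MonoidAlgebra ℤ G) (Additive (Sf.unit F))]
    (hmU : ∀ (g : G) (u v : Sf.unit F), ((v : Fˣ) : F) = iso g ((u : Fˣ) : F) →
      (MonoidAlgebra.single g (1 : ℤ) : MonoidAlgebra ℤ G) • Additive.ofMul u =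
        Additive.ofMul v)
    -- the ℤ[G]-module Cl_{F,S}, the class group of the ring of S-integers
    [mCl : Module (MonoidAlgebra ℤ G) (Additive (ClassGroup (Sf.integer F)))]
    (hmCl : ∀ (g : G) (I J : (Ideal (Sf.integer F))⁰),
      ((fun x : Sf.integer F => (x : F)) ''
          ((J : Ideal (Sf.integer F)) : Set (Sf.integer F)) =
        iso g '' ((fun x : Sf.integer F => (x : F)) ''
          ((I : Ideal (Sf.integer F)) : Set (Sf.integer F)))) →
      (MonoidAlgebra.single g (1 : ℤ) : MonoidAlgebra ℤ G) •
          Additive.ofMul (ClassGroup.mk0 I) = Additive.ofMul (ClassGroup.mk0 J))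
    -- a finite G-stable set S' of places of F containing all archimedean places,
    -- given by its set Sf' of non-archimedean places (the archimedean ones are always included)
    (Sf' : Set (IsDedekindDomain.HeightOneSpectrum (𝓞 F))) (hSf'fin : Sf'.Finite)
    [IsDedekindDomain (Sf'.integer F)]
    -- the G-action on the finite places in S' (G-stability of S')
    (act' : G → {v // v ∈ Sf'} → {v // v ∈ Sf'})
    (hact' : ∀ (g : G) (v : {v // v ∈ Sf'}),
      algebraMap (𝓞 F) F ''
          (((act' g v : IsDedekindDomain.HeightOneSpectrum (𝓞 F))).asIdeal : Set (𝓞 F)) =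
        iso g '' (algebraMap (𝓞 F) F ''
          ((v : IsDedekindDomain.HeightOneSpectrum (𝓞 F)).asIdeal : Set (𝓞 F))))
    -- the permutation module ℤ[S']
    [mS' : Module (MonoidAlgebra ℤ G)
      ((NumberField.InfinitePlace F ⊕ {v // v ∈ Sf'}) →₀ ℤ)]
    (hmS' : ∀ (g : G) (x : (NumberField.InfinitePlace F ⊕ {v // v ∈ Sf'}) →₀ ℤ),
      (MonoidAlgebra.single g (1 : ℤ) : MonoidAlgebra ℤ G) • x =
        Finsupp.mapDomain (Sum.map (fun w => iso g • w) (act' g)) x)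
    -- the ℤ[G]-module of S'-units O_{F,S'}^×
    [mU' : Module (MonoidAlgebra ℤ G) (Additive (Sf'.unit F))]
    (hmU' : ∀ (g : G) (u v : Sf'.unit F), ((v : Fˣ) : F) = iso g ((u : Fˣ) : F) →
      (MonoidAlgebra.single g (1 : ℤ) : MonoidAlgebra ℤ G) • Additive.ofMul u =
        Additive.ofMul v)
    -- the ℤ[G]-module Cl_{F,S'}, the class group of the ring of S'-integers
    [mCl' : Module (MonoidAlgebra ℤ G) (Additive (ClassGroup (Sf'.integer F)))]
    (hmCl' : ∀ (g : G) (I J : (Ideal (Sf'.integer F))⁰),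
      ((fun x : Sf'.integer F => (x : F)) ''
          ((J : Ideal (Sf'.integer F)) : Set (Sf'.integer F)) =
        iso g '' ((fun x : Sf'.integer F => (x : F)) ''
          ((I : Ideal (Sf'.integer F)) : Set (Sf'.integer F)))) →
      (MonoidAlgebra.single g (1 : ℤ) : MonoidAlgebra ℤ G) •
          Additive.ofMul (ClassGroup.mk0 I) = Additive.ofMul (ClassGroup.mk0 J))
 :
    G0.cls (MonoidAlgebra ℤ G) ((NumberField.InfinitePlace F ⊕ {v // v ∈ Sf'}) →₀ ℤ) - G0.cls (MonoidAlgebra ℤ G) (Additive (Sf'.unit F)) + G0.cls (MonoidAlgebra ℤ G) (Additive (ClassGroup (Sf'.integer F))) =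
      G0.cls (MonoidAlgebra ℤ G) ((NumberField.InfinitePlace F ⊕ {v // v ∈ Sf}) →₀ ℤ) - G0.cls (MonoidAlgebra ℤ G) (Additive (Sf.unit F)) + G0.cls (MonoidAlgebra ℤ G) (Additive (ClassGroup (Sf.integer F))) := by
  have : Finite G := Finite.of_equiv _ iso.symm.toEquiv
  let : Module (MonoidAlgebra ℤ G) (Additive Fˣ) :=
    groupRingModule ((NumberField.galUnits K F).comp iso.toMonoidHom)
  let : Module (MonoidAlgebra ℤ G) (NumberField.PlaceDivisor F) :=
    groupRingModule ((NumberField.galDivisor (K := K)).comp iso.toMonoidHom)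
  have hM : ∀ (g : G) (x : Additive Fˣ), (MonoidAlgebra.single g (1 : ℤ) : MonoidAlgebra ℤ G) • x =
      NumberField.galUnits K F (iso g) x := groupRingModule_single_smul _
  have hN : ∀ (g : G) (n : NumberField.PlaceDivisor F),
      (MonoidAlgebra.single g (1 : ℤ) : MonoidAlgebra ℤ G) • n =
        NumberField.galDivisor (iso g) n := groupRingModule_single_smul _
  let φ := equivariantLinearMap (G := G) (NumberField.placeDivisor F) fun g x => by
    rw [hM, hN, NumberField.placeDivisor_galUnits]
  rw [NumberField.cls_sub_cls_unit_add_cls_classGroup iso hM hN φ (fun _ => rfl) Sf hSffin act hact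
      hmS hmU hmCl,
    NumberField.cls_sub_cls_unit_add_cls_classGroup iso hM hN φ (fun _ => rfl) Sf' hSf'fin act'
      hact' hmS' hmU' hmCl']
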